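/- Let k ≥ 3, n ≥ 2, 1 ≤ s ≤ n−1, and let c₀ ∈ B_s. In any legal firing sequence starting from c₀ with the bank vertex 0 fired exactly once at the first step, every configuration c' occurring strictly after a step at which the vertex s(k−1) is fired on the edge e_{s+1} satisfies ∑_{v=s(k−1)+1}^{n(k−1)} c'(v) > ∑_{v=s(k−1)+1}^{n(k−1)} c₀(v). -/

import Mathlib

open Finset

/-- Vertex `v` belongs to the edge `e_t = {(t-1)(k-1), …, t(k-1)}` of the
hyperpath `P_n^k`. -/
def inEdge (k t v : ℕ) : Prop := (t - 1) * (k - 1) ≤ v ∧ v ≤ t * (k - 1)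

instance (k t v : ℕ) : Decidable (inEdge k t v) :=
  inferInstanceAs (Decidable (_ ∧ _))

/-- Firing the vertex `u` on the edge `e_t` of `P_n^k`: `u` loses `k-1` dollars
and every other vertex of `e_t` gains one dollar. -/
def fireStep (k t u : ℕ) (c : ℕ → ℤ) : ℕ → ℤ := fun v =>
  if v = u then c u - ((k : ℤ) - 1)
  else if inEdge k t v then c v + 1
  else c v

/-- A configuration on `P_n^k` (bank vertex `0`) is stable: at every vertex
`v ≠ 0` its value lies in `{0, …, k-2}`. -/
def StableConf (k n : ℕ) (c : ℕ → ℤ) : Prop :=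
  ∀ v, 1 ≤ v → v ≤ n * (k - 1) → 0 ≤ c v ∧ c v ≤ (k : ℤ) - 2

/-- A legal firing sequence on the hyperpath `P_n^k` with bank vertex `0`,
starting from a stable configuration `conf 0`, in which the bank is fired
exactly once, at the first step (on the edge `e₁`).  At every later step the
fired vertex is the largest vertex `v ≠ 0` whose value is `≥ k-1`, fired on
some edge containing it. -/
structure FiringSeq (k n : ℕ) where
  /-- the number of firing steps -/
  len : ℕ
  /-- the configurations `conf 0, conf 1, …, conf len` -/
  conf : ℕ → ℕ → ℤ
  /-- the vertex fired at step `j` (for `j < len`) -/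
  vert : ℕ → ℕ
  /-- the index of the edge on which step `j` fires (for `j < len`) -/
  edg : ℕ → ℕ
  one_le_len : 1 ≤ len
  start_stable : StableConf k n (conf 0)
  edg_mem : ∀ j < len, 1 ≤ edg j ∧ edg j ≤ n
  vert_mem : ∀ j < len, inEdge k (edg j) (vert j)
  conf_step : ∀ j < len, conf (j + 1) = fireStep k (edg j) (vert j) (conf j)
  first_vert : vert 0 = 0
  first_edg : edg 0 = 1
  bank_once : ∀ j, 1 ≤ j → j < len → vert j ≠ 0
  fire_legal : ∀ j, 1 ≤ j → j < len →
    (k : ℤ) - 1 ≤ conf j (vert j) ∧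
    ∀ v, vert j < v → v ≤ n * (k - 1) → conf j v < (k : ℤ) - 1

/-- Firing the vertex `u` on the complete graph `K_k` with vertex set
`{0, …, k-1}`: `u` loses `k-1` dollars and every other vertex gains one. -/
def fireK (k u : ℕ) (d : ℕ → ℤ) : ℕ → ℤ := fun v =>
  if v = u then d u - ((k : ℤ) - 1)
  else if v ≤ k - 1 then d v + 1
  else d v

/-- A configuration on `K_k` (vertices `{0,…,k-1}`, bank vertex `0`) is stable:
every non-bank vertex has value in `{0, …, k-2}`. -/
def StableK (k : ℕ) (d : ℕ → ℤ) : Prop :=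
  ∀ v, 1 ≤ v → v ≤ k - 1 → 0 ≤ d v ∧ d v ≤ (k : ℤ) - 2

/-- A stable configuration `d` on the complete graph `K_k` (vertices
`{0,…,k-1}`, bank vertex `0`) is critical: there is a nonempty `0`-legal firing
sequence starting and ending at `d` (non-bank vertices are fired only when
their value is `≥ k-1`; the bank is fired only at a stable configuration). -/
def CriticalK (k : ℕ) (d : ℕ → ℤ) : Prop :=
  StableK k d ∧
  ∃ (N : ℕ) (cs : ℕ → ℕ → ℤ) (vs : ℕ → ℕ),
    1 ≤ N ∧ cs 0 = d ∧ cs N = d ∧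
    (∀ j < N, vs j ≤ k - 1) ∧
    (∀ j < N, cs (j + 1) = fireK k (vs j) (cs j)) ∧
    (∀ j < N, vs j ≠ 0 → (k : ℤ) - 1 ≤ cs j (vs j)) ∧
    (∀ j < N, vs j = 0 → StableK k (cs j))

/-- The configuration `c̃^i` induced on the complete graph with vertex set
`e_i` and bank vertex `(i-1)(k-1)` by a configuration `c` on `P_n^k`. -/
def inducedConf (k i : ℕ) (c : ℕ → ℤ) : ℕ → ℤ := fun j => c ((i - 1) * (k - 1) + j)

/-- Membership of a configuration `c` on `P_n^k` in the set `B_s`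
(for `0 ≤ s ≤ n`): `c` is stable, `c̃^i` is critical for `1 ≤ i ≤ s`, and,
if `s < n`, `c̃^{s+1}` is not critical. -/
def MemB (k n s : ℕ) (c : ℕ → ℤ) : Prop :=
  StableConf k n c ∧
  (∀ i, 1 ≤ i → i ≤ s → CriticalK k (inducedConf k i c)) ∧
  (s < n → ¬ CriticalK k (inducedConf k (s + 1) c))

section CompleteGraph

/-- The configuration obtained from `d` on `K_k` by firing every vertex of `F` once. -/
def fireSetK (k : ℕ) (d : ℕ → ℤ) (F : Finset ℕ) : ℕ → ℤ := fun v =>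
  if v < k then d v + #F - (if v ∈ F then (k : ℤ) else 0) else d v

lemma fireSetK_insert {k : ℕ} (d : ℕ → ℤ) {F : Finset ℕ} {u : ℕ} (hu : u < k) (huF : u ∉ F) :
    fireSetK k d (insert u F) = fireK k u (fireSetK k d F) := by
  funext v
  simp only [fireSetK, fireK, card_insert_of_notMem huF, mem_insert]
  by_cases hvu : v = u
  · subst hvu
    simp [hu, huF]
    ring
  · by_cases hv : v < k
    · have : v ≤ k - 1 := by omega
      simp [hvu, hv, this]
      ring
    · have : ¬ v ≤ k - 1 := by omega
      simp [hvu, hv, this]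

/-- The burning criterion: if every nonempty set `A` of non-bank vertices contains a vertex of
value at least `#A - 1`, then the stable configuration is critical. -/
lemma criticalK_of_burning {k : ℕ} (hk : 1 ≤ k) {d : ℕ → ℤ} (hd : StableK k d)
    (h : ∀ A ⊆ Icc 1 (k - 1), A.Nonempty → ∃ v ∈ A, (#A : ℤ) ≤ d v + 1) :
    CriticalK k d := by
  have next : ∀ F : Finset ℕ, ∃ v, F ⊆ range k → #F < k → (F = ∅ ∨ 0 ∈ F) →
      v < k ∧ v ∉ F ∧ (F = ∅ → v = 0) ∧ (v = 0 → F = ∅) ∧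
        (v ≠ 0 → (k : ℤ) - 1 ≤ d v + #F) := by
    intro F
    by_cases hF : F ⊆ range k ∧ #F < k ∧ (F = ∅ ∨ 0 ∈ F)
    · obtain ⟨hsub, hcard, rfl | h0⟩ := hF
      · exact ⟨0, fun _ _ _ => ⟨by omega, by simp, by simp, by simp, by simp⟩⟩
      · have hA : #(range k \ F) = k - #F := by rw [card_sdiff_of_subset hsub, card_range]
        obtain ⟨v, hv, hdv⟩ := h (range k \ F)
          (by
            intro v hv
            simp only [mem_sdiff, mem_range] at hv
            have : v ≠ 0 := by rintro rfl; exact hv.2 h0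
            rw [mem_Icc]
            omega)
          (by rw [← card_pos]; omega)
        simp only [mem_sdiff, mem_range] at hv
        have hv0 : v ≠ 0 := by rintro rfl; exact hv.2 h0
        refine ⟨v, fun _ _ _ => ⟨hv.1, hv.2, ?_, fun h => absurd h hv0, fun _ => ?_⟩⟩
        · rintro rfl
          simp at h0
        · rw [hA] at hdv
          omega
    · exact ⟨0, fun h1 h2 h3 => absurd ⟨h1, h2, h3⟩ hF⟩
  choose g hg using next
  let Fs : ℕ → Finset ℕ := fun i => Nat.rec ∅ (fun _ F => insert (g F) F) i
  have Fs_zero : Fs 0 = ∅ := rfl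
  have Fs_succ : ∀ i, Fs (i + 1) = insert (g (Fs i)) (Fs i) := fun _ => rfl
  have hFs : ∀ i ≤ k, Fs i ⊆ range k ∧ #(Fs i) = i ∧ (Fs i = ∅ ∨ 0 ∈ Fs i) := by
    intro i
    induction i with
    | zero => intro _; simp [Fs_zero]
    | succ i ih =>
      intro hi
      obtain ⟨h1, h2, h3⟩ := ih (by omega)
      obtain ⟨g1, g2, g3, -, -⟩ := hg (Fs i) h1 (by omega) h3
      rw [Fs_succ]
      refine ⟨insert_subset (mem_range.2 g1) h1, by rw [card_insert_of_notMem g2, h2], Or.inr ?_⟩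
      rcases h3 with h3 | h3
      · rw [g3 h3]
        exact mem_insert_self _ _
      · exact mem_insert_of_mem h3
  have hgFs : ∀ i < k, _ := fun i hi =>
    hg (Fs i) (hFs i hi.le).1 (by rw [(hFs i hi.le).2.1]; exact hi) (hFs i hi.le).2.2
  have fire_empty : fireSetK k d ∅ = d := by
    funext v
    simp [fireSetK]
  refine ⟨hd, k, fun i => fireSetK k d (Fs i), fun i => g (Fs i), hk, fire_empty, ?_, ?_, ?_, ?_, ?_⟩
  · have : Fs k = range k := eq_of_subset_of_card_le (hFs k le_rfl).1
      (by rw [(hFs k le_rfl).2.1, card_range])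
    funext v
    simp only [fireSetK, this, card_range, mem_range]
    split_ifs <;> ring
  · intro i hi
    have := (hgFs i hi).1
    show g (Fs i) ≤ k - 1
    omega
  · intro i hi
    show fireSetK k d (Fs (i + 1)) = _
    rw [Fs_succ]
    exact fireSetK_insert d (hgFs i hi).1 (hgFs i hi).2.1
  · intro i hi h0
    obtain ⟨g1, g2, -, -, g5⟩ := hgFs i hi
    simpa [fireSetK, g1, g2] using g5 h0
  · intro i hi h0
    show StableK k (fireSetK k d (Fs i))
    rw [(hgFs i hi).2.2.2.1 h0, fire_empty]
    exact hd

end CompleteGraph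

section Hyperpath

/-- The vertex set of the edge `e_{r+1}` of the hyperpath. -/
def edgeVerts (k r : ℕ) : Finset ℕ := Icc (r * (k - 1)) (r * (k - 1) + (k - 1))

lemma inEdge_succ_iff {k r v : ℕ} : inEdge k (r + 1) v ↔ v ∈ edgeVerts k r := by
  simp [inEdge, edgeVerts, add_mul]

lemma card_edgeVerts {k : ℕ} (hk : 1 ≤ k) (r : ℕ) : #(edgeVerts k r) = k := by
  simp only [edgeVerts, Nat.card_Icc]
  omega

variable {k n : ℕ}

namespace FiringSeq

/-- How often, among the first `j` steps, the vertex `u` is fired on the edge `e_{r+1}`. -/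
def fireCount (S : FiringSeq k n) (j r u : ℕ) : ℤ :=
  ∑ i ∈ range j, if S.edg i = r + 1 ∧ S.vert i = u then 1 else 0

/-- The net amount received by `v` through firings on `e_{r+1}` during the first `j` steps. -/
def netGain (S : FiringSeq k n) (j r v : ℕ) : ℤ :=
  if v ∈ edgeVerts k r then ∑ u ∈ edgeVerts k r, S.fireCount j r u - k * S.fireCount j r v else 0

lemma fireCount_zero (S : FiringSeq k n) (r u : ℕ) : S.fireCount 0 r u = 0 := by
  simp [fireCount]

lemma fireCount_succ (S : FiringSeq k n) (j r u : ℕ) :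
    S.fireCount (j + 1) r u =
      S.fireCount j r u + if S.edg j = r + 1 ∧ S.vert j = u then 1 else 0 := by
  simp only [fireCount, sum_range_succ]

lemma fireCount_nonneg (S : FiringSeq k n) (j r u : ℕ) : 0 ≤ S.fireCount j r u :=
  sum_nonneg fun _ _ => by split_ifs <;> simp

lemma fireCount_mono (S : FiringSeq k n) {i j : ℕ} (hij : i ≤ j) (r u : ℕ) :
    S.fireCount i r u ≤ S.fireCount j r u :=
  sum_le_sum_of_subset_of_nonneg (range_subset_range.2 hij) fun _ _ _ => by split_ifs <;> simp

lemma netGain_succ (S : FiringSeq k n) {j : ℕ} (hj : j < S.len) (r v : ℕ) :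
    S.netGain (j + 1) r v = S.netGain j r v +
      if S.edg j = r + 1 ∧ v ∈ edgeVerts k r then (if S.vert j = v then 1 - (k : ℤ) else 1)
      else 0 := by
  by_cases hv : v ∈ edgeVerts k r
  · by_cases he : S.edg j = r + 1
    · have hu : S.vert j ∈ edgeVerts k r := by
        rw [← inEdge_succ_iff, ← he]
        exact S.vert_mem j hj
      simp only [netGain, hv, he, fireCount_succ, sum_add_distrib, sum_ite_eq, hu, if_true,
        true_and, and_true]
      split_ifs <;> ring
    · simp [netGain, hv, he, fireCount_succ]
  · simp [netGain, hv]

lemma conf_eq (S : FiringSeq k n) {j : ℕ} (hj : j ≤ S.len) (v : ℕ) :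
    S.conf j v = S.conf 0 v + ∑ r ∈ range n, S.netGain j r v := by
  induction j with
  | zero => simp [netGain, fireCount_zero]
  | succ j ih =>
    have hjl : j < S.len := hj
    obtain ⟨he1, he2⟩ := S.edg_mem j hjl
    obtain ⟨r, hr⟩ : ∃ r, S.edg j = r + 1 := ⟨S.edg j - 1, by omega⟩
    have hu := S.vert_mem j hjl
    rw [hr, inEdge_succ_iff] at hu
    have hrn : r ∈ range n := mem_range.2 (by omega)
    have hsum : ∑ q ∈ range n, (if S.edg j = q + 1 ∧ v ∈ edgeVerts k q then
        (if S.vert j = v then 1 - (k : ℤ) else 1) else 0) =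
        if v ∈ edgeVerts k r then (if S.vert j = v then 1 - (k : ℤ) else 1) else 0 := by
      rw [sum_eq_single_of_mem r hrn]
      · simp [hr]
      · intro q _ hq
        rw [if_neg]
        rintro ⟨h, -⟩
        omega
    simp only [S.netGain_succ hjl, sum_add_distrib, hsum]
    rw [← add_assoc, ← ih hjl.le, S.conf_step j hjl, hr]
    simp only [fireStep, inEdge_succ_iff]
    by_cases hvu : v = S.vert j
    · subst hvu
      simp [hu]
      ring
    · rw [if_neg hvu]
      have : S.vert j ≠ v := fun h => hvu h.symm
      split_ifs <;> simp

/-- During the first `j` steps no vertex of an edge is fired on it more often than the smallest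
vertex of that edge. -/
def BankDominates (S : FiringSeq k n) (j : ℕ) : Prop :=
  ∀ r < n, ∀ v ∈ edgeVerts k r, S.fireCount j r v ≤ S.fireCount j r (r * (k - 1))

lemma BankDominates.netGain_bank_nonpos {S : FiringSeq k n} {j : ℕ} (h : S.BankDominates j)
    (hk : 1 ≤ k) {r : ℕ} (hr : r < n) : S.netGain j r (r * (k - 1)) ≤ 0 := by
  have := sum_le_card_nsmul (edgeVerts k r) _ _ (h r hr)
  rw [card_edgeVerts hk, nsmul_eq_mul] at this
  rw [netGain]
  split_ifs <;> linarith

lemma BankDominates.conf_le {S : FiringSeq k n} {j : ℕ} (h : S.BankDominates j) (hk : 1 ≤ k)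
    (hj : j ≤ S.len) {r v : ℕ} (hr : r < n) (hv : v ∈ edgeVerts k r) (hvb : v ≠ r * (k - 1)) :
    S.conf j v ≤
      S.conf 0 v + (∑ u ∈ edgeVerts k r, S.fireCount j r u - k * S.fireCount j r v) := by
  rw [S.conf_eq hj, ← add_sum_erase _ _ (mem_range.2 hr)]
  have hrest : ∑ q ∈ (range n).erase r, S.netGain j q v ≤ 0 := by
    refine sum_nonpos fun q hq => ?_
    simp only [mem_erase, mem_range] at hq
    by_cases hvq : v ∈ edgeVerts k q
    · simp only [edgeVerts, mem_Icc] at hv hvq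
      have hvbank : v = q * (k - 1) := by
        rcases lt_or_gt_of_ne hq.1 with hlt | hlt
        · have := Nat.mul_le_mul_right (k - 1) (Nat.succ_le_of_lt hlt)
          rw [Nat.succ_mul] at this
          omega
        · have := Nat.mul_le_mul_right (k - 1) (Nat.succ_le_of_lt hlt)
          rw [Nat.succ_mul] at this
          omega
      rw [hvbank]
      exact h.netGain_bank_nonpos hk hq.2
    · simp [netGain, hvq]
  have : S.netGain j r v =
      ∑ u ∈ edgeVerts k r, S.fireCount j r u - k * S.fireCount j r v := if_pos hv
  linarith

lemma conf_zero_le (S : FiringSeq k n) {r v : ℕ} (hr : r < n) (hv : v ∈ edgeVerts k r)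
    (hvb : v ≠ r * (k - 1)) : S.conf 0 v ≤ (k : ℤ) - 2 := by
  simp only [edgeVerts, mem_Icc] at hv
  have := Nat.mul_le_mul_right (k - 1) (Nat.succ_le_of_lt hr)
  rw [Nat.succ_mul] at this
  exact (S.start_stable v (by omega) (by omega)).2

/-- A vertex of `e_{r+1}` other than the smallest one is fired only when it is unstable. -/
lemma le_conf_of_fired (S : FiringSeq k n) {j r : ℕ} (hj : j < S.len)
    (hv : S.vert j ∈ edgeVerts k r) (hvb : S.vert j ≠ r * (k - 1)) :
    (k : ℤ) - 1 ≤ S.conf j (S.vert j) := by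
  refine (S.fire_legal j (Nat.one_le_iff_ne_zero.2 ?_) hj).1
  rintro rfl
  simp only [edgeVerts, mem_Icc, S.first_vert] at hv hvb
  omega

lemma bankDominates (S : FiringSeq k n) (hk : 1 ≤ k) {j : ℕ} (hj : j ≤ S.len) :
    S.BankDominates j := by
  induction j with
  | zero => intro r _ v _; simp [fireCount_zero]
  | succ j ih =>
    have hjl : j < S.len := hj
    have hdom := ih hjl.le
    intro r hr v hv
    by_cases hvb : v = r * (k - 1)
    · rw [hvb]
    have hle := hdom r hr v hv
    have hmono := S.fireCount_mono (Nat.le_succ j) r (r * (k - 1))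
    by_cases hfire : S.edg j = r + 1 ∧ S.vert j = v
    · obtain ⟨he, rfl⟩ := hfire
      have hbig := S.le_conf_of_fired hjl hv hvb
      have hconf := hdom.conf_le hk hjl.le hr hv hvb
      have hinit := S.conf_zero_le hr hv hvb
      have hsum := sum_le_card_nsmul (edgeVerts k r) _ _ (hdom r hr)
      rw [card_edgeVerts hk, nsmul_eq_mul] at hsum
      have hlt : S.fireCount j r (S.vert j) < S.fireCount j r (r * (k - 1)) := by
        refine lt_of_le_of_ne hle fun heq => ?_
        rw [heq] at hconf
        linarith
      rw [S.fireCount_succ j r (S.vert j)]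
      simp only [he, and_self, if_true]
      exact le_trans hlt hmono
    · rw [S.fireCount_succ j r v, if_neg hfire, add_zero]
      exact hle.trans hmono

/-- If `A` is a set of vertices of `e_{r+1}`, not containing the smallest one, all of whose initial
values are at most `#A - 2`, then each vertex of `A` is fired on `e_{r+1}` strictly less often than
the smallest vertex, as soon as the latter has been fired there. -/
lemma fireCount_lt_of_small (S : FiringSeq k n) (hk : 1 ≤ k) {r : ℕ} (hr : r < n)
    {A : Finset ℕ} (hA : A ⊆ edgeVerts k r) (hb : r * (k - 1) ∉ A)
    (hsmall : ∀ v ∈ A, S.conf 0 v + 2 ≤ #A) {j : ℕ} (hj : j ≤ S.len)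
    (hpos : 0 < S.fireCount j r (r * (k - 1))) :
    ∀ v ∈ A, S.fireCount j r v < S.fireCount j r (r * (k - 1)) := by
  induction j with
  | zero => simp [fireCount_zero] at hpos
  | succ j ih =>
    have hjl : j < S.len := hj
    have hdom := S.bankDominates hk hjl.le
    intro v hvA
    have hv := hA hvA
    have hvb : v ≠ r * (k - 1) := by rintro rfl; exact hb hvA
    by_cases hbank : S.edg j = r + 1 ∧ S.vert j = r * (k - 1)
    · have hnot : ¬ (S.edg j = r + 1 ∧ S.vert j = v) := fun h => hvb (h.2.symm.trans hbank.2)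
      rw [fireCount_succ, fireCount_succ, if_neg hnot, if_pos hbank]
      linarith [hdom r hr v hv]
    · rw [S.fireCount_succ j r (r * (k - 1)), if_neg hbank, add_zero] at hpos ⊢
      have hlt := ih hjl.le hpos
      by_cases hfire : S.edg j = r + 1 ∧ S.vert j = v
      · rw [fireCount_succ, if_pos hfire]
        obtain ⟨he, rfl⟩ := hfire
        refine lt_of_le_of_ne (hlt _ hvA) fun heq => ?_
        have hbig := S.le_conf_of_fired hjl hv hvb
        have hconf := hdom.conf_le hk hjl.le hr hv hvb
        have hinA := sum_le_card_nsmul A (fun u => S.fireCount j r u)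
          (S.fireCount j r (r * (k - 1)) - 1) (fun u hu => Int.le_sub_one_of_lt (hlt u hu))
        have hout := sum_le_card_nsmul (edgeVerts k r \ A) (fun u => S.fireCount j r u)
          (S.fireCount j r (r * (k - 1))) (fun u hu => hdom r hr u (mem_sdiff.1 hu).1)
        have hsplit := sum_sdiff (f := fun u => S.fireCount j r u) hA
        have hcard : (#(edgeVerts k r \ A) : ℤ) = k - #A := by
          rw [card_sdiff_of_subset hA, card_edgeVerts hk, Nat.cast_sub]
          rw [← card_edgeVerts hk r]
          exact card_le_card hA
        rw [nsmul_eq_mul] at hinA hout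
        rw [hcard] at hout
        have := hsmall _ hvA
        rw [← heq] at hinA hout
        linarith
      · rw [fireCount_succ, if_neg hfire, add_zero]
        exact hlt v hvA

lemma sum_netGain_edgeVerts (S : FiringSeq k n) (hk : 1 ≤ k) (j r : ℕ) :
    ∑ v ∈ edgeVerts k r, S.netGain j r v = 0 := by
  have : ∀ v ∈ edgeVerts k r, S.netGain j r v =
      ∑ u ∈ edgeVerts k r, S.fireCount j r u - k * S.fireCount j r v := fun v hv => if_pos hv
  rw [sum_congr rfl this, sum_sub_distrib, sum_const, card_edgeVerts hk, ← mul_sum]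
  simp

/-- The tail beyond the vertex `s(k-1)` gains exactly what that vertex loses on `e_{s+1}`. -/
lemma sum_tail_conf (S : FiringSeq k n) (hk : 2 ≤ k) {s : ℕ} (hs : s < n) {j : ℕ}
    (hj : j ≤ S.len) :
    ∑ v ∈ Icc (s * (k - 1) + 1) (n * (k - 1)), S.conf j v =
      ∑ v ∈ Icc (s * (k - 1) + 1) (n * (k - 1)), S.conf 0 v -
        S.netGain j s (s * (k - 1)) := by
  have hrow : ∀ r < n, ∑ v ∈ Icc (s * (k - 1) + 1) (n * (k - 1)), S.netGain j r v =
      if r = s then - S.netGain j s (s * (k - 1)) else 0 := by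
    intro r hr
    have hrn := Nat.mul_le_mul_right (k - 1) (Nat.succ_le_of_lt hr)
    rw [Nat.succ_mul] at hrn
    have hout : ∀ v, v ∉ edgeVerts k r → S.netGain j r v = 0 := fun v hv => if_neg hv
    rcases lt_trichotomy r s with hlt | rfl | hlt
    · have := Nat.mul_le_mul_right (k - 1) (Nat.succ_le_of_lt hlt)
      rw [Nat.succ_mul] at this
      rw [if_neg hlt.ne]
      refine sum_eq_zero fun v hv => hout v fun hv' => ?_
      simp only [edgeVerts, mem_Icc] at hv hv'
      omega
    · have hb : r * (k - 1) ∈ edgeVerts k r := by simp [edgeVerts]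
      have htail : ∑ v ∈ (edgeVerts k r).erase (r * (k - 1)), S.netGain j r v =
          ∑ v ∈ Icc (r * (k - 1) + 1) (n * (k - 1)), S.netGain j r v := by
        refine sum_subset (fun v hv => ?_) fun v hv hv' => hout v fun hve => hv' ?_
        · simp only [edgeVerts, mem_erase, mem_Icc] at hv ⊢
          omega
        · simp only [mem_Icc] at hv
          exact mem_erase.2 ⟨by omega, hve⟩
      have := add_sum_erase _ (fun v => S.netGain j r v) hb
      rw [S.sum_netGain_edgeVerts (by omega)] at this
      rw [if_pos rfl, ← htail]
      linarith
    · have hsr := Nat.mul_le_mul_right (k - 1) (Nat.succ_le_of_lt hlt)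
      rw [Nat.succ_mul] at hsr
      rw [if_neg hlt.ne', ← S.sum_netGain_edgeVerts (by omega) j r]
      refine (sum_subset (fun v hv => ?_) fun v _ hv' => hout v hv').symm
      simp only [edgeVerts, mem_Icc] at hv ⊢
      omega
  simp only [S.conf_eq hj, sum_add_distrib]
  rw [sum_comm, sum_congr rfl fun r hr => hrow r (mem_range.1 hr), sum_ite_eq',
    if_pos (mem_range.2 hs)]
  ring

end FiringSeq

end Hyperpath

/-- For `1 ≤ s ≤ n-1` and `c₀ ∈ B_s`: in any legal firing sequence starting
from `c₀` (bank fired exactly once, at the first step), every configuration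
occurring strictly after a step at which the vertex `s(k-1)` is fired on the
edge `e_{s+1}` has a strictly larger sum of values over the vertices
`s(k-1)+1, …, n(k-1)` than `c₀` does. -/
theorem hyperpath_tail_weight_increases (k n s : ℕ) (hk : 3 ≤ k) (hn : 2 ≤ n)
    (hs1 : 1 ≤ s) (hs2 : s ≤ n - 1) (c0 : ℕ → ℤ) (hc0 : MemB k n s c0)
    (S : FiringSeq k n) (hstart : S.conf 0 = c0)
    (j0 : ℕ) (hj0 : j0 < S.len)
    (hv : S.vert j0 = s * (k - 1)) (he : S.edg j0 = s + 1)
    (j : ℕ) (hj1 : j0 < j) (hj2 : j ≤ S.len) :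
    ∑ v ∈ Finset.Icc (s * (k - 1) + 1) (n * (k - 1)), c0 v <
      ∑ v ∈ Finset.Icc (s * (k - 1) + 1) (n * (k - 1)), S.conf j v := by
  have hk1 : 1 ≤ k := by omega
  have hsn : s < n := by omega
  subst hstart
  have hstable : StableK k (inducedConf k (s + 1) (S.conf 0)) := by
    intro v hv1 hv2
    have := Nat.mul_le_mul_right (k - 1) (Nat.succ_le_of_lt hsn)
    rw [Nat.succ_mul] at this
    exact S.start_stable _ (by omega) (by simp only [Nat.add_sub_cancel]; omega)
  obtain ⟨A, hA, hne, hsmall⟩ : ∃ A ⊆ Icc 1 (k - 1), A.Nonempty ∧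
      ∀ v ∈ A, inducedConf k (s + 1) (S.conf 0) v + 1 < #A := by
    by_contra! hcon
    exact hc0.2.2 hsn (criticalK_of_burning hk1 hstable hcon)
  let A' := A.map (addLeftEmbedding (s * (k - 1)))
  have hA' : A' ⊆ edgeVerts k s := by
    intro v hv
    obtain ⟨a, ha, rfl⟩ := mem_map.1 hv
    have := mem_Icc.1 (hA ha)
    simp only [addLeftEmbedding_apply, edgeVerts, mem_Icc]
    omega
  have hb : s * (k - 1) ∉ A' := by
    intro hv
    obtain ⟨a, ha, hav⟩ := mem_map.1 hv
    have := mem_Icc.1 (hA ha)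
    simp only [addLeftEmbedding_apply] at hav
    omega
  have hsmall' : ∀ v ∈ A', S.conf 0 v + 2 ≤ #A' := by
    intro v hv
    obtain ⟨a, ha, rfl⟩ := mem_map.1 hv
    have := hsmall a ha
    simp only [inducedConf, Nat.add_sub_cancel] at this
    simp only [A', card_map, addLeftEmbedding_apply]
    omega
  have hpos : 0 < S.fireCount j s (s * (k - 1)) := by
    have h1 := S.fireCount_mono (Nat.succ_le_of_lt hj1) s (s * (k - 1))
    have h2 := S.fireCount_succ j0 s (s * (k - 1))
    rw [if_pos ⟨he, hv⟩] at h2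
    have h3 := S.fireCount_nonneg j0 s (s * (k - 1))
    rw [Nat.succ_eq_add_one] at h1
    linarith
  have hlt := S.fireCount_lt_of_small hk1 hsn hA' hb hsmall' hj2 hpos
  obtain ⟨v, hvA⟩ : A'.Nonempty := hne.map
  have hsum := sum_lt_sum (S.bankDominates hk1 hj2 s hsn) ⟨v, hA' hvA, hlt v hvA⟩
  rw [sum_const, card_edgeVerts hk1, nsmul_eq_mul] at hsum
  have hnet : S.netGain j s (s * (k - 1)) = ∑ u ∈ edgeVerts k s, S.fireCount j s u -
      k * S.fireCount j s (s * (k - 1)) := if_pos (by simp [edgeVerts])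
  rw [S.sum_tail_conf (by omega) hsn hj2]
  linarith
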